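/- Counting theorem for finitely forbidden families: Let k ≥ 2 and N ∈ ℕ be fixed, let F be a nonempty collection of k-colourings of K_N, and set P = Forb(F); assume P_n ≠ ∅ for all n so that π(P) is defined. For every ε > 0 there exists n₀ such that for all n ≥ n₀, k^{π(P)·C(n,2)} ≤ |P_n| ≤ k^{(π(P)+ε)·C(n,2)}. -/

import Mathlib

open Filter

abbrev Edge (n : ℕ) := {p : Fin n × Fin n // p.1 < p.2}

abbrev Colouring (k n : ℕ) := Edge n → Fin k

abbrev Template (k n : ℕ) := Edge n → Finset (Fin k)

def Proper {k n : ℕ} (t : Template k n) : Prop := ∀ e, (t e).Nonempty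

def Realises {k n : ℕ} (c : Colouring k n) (t : Template k n) : Prop := ∀ e, c e ∈ t e

noncomputable def Ent {k n : ℕ} (t : Template k n) : ℝ :=
  ∑ e : Edge n, Real.logb k ((t e).card)

def Edge.map {m n : ℕ} (φ : Fin m → Fin n) (h : StrictMono φ) (e : Edge m) : Edge n :=
  ⟨(φ e.1.1, φ e.1.2), h e.2⟩

def restrictC {k m n : ℕ} (c : Colouring k n) (φ : Fin m → Fin n) (h : StrictMono φ) :
    Colouring k m := fun e => c (Edge.map φ h e)

def restrictT {k m n : ℕ} (t : Template k n) (φ : Fin m → Fin n) (h : StrictMono φ) :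
    Template k m := fun e => t (Edge.map φ h e)

def Forb {k N : ℕ} (F : Set (Colouring k N)) (n : ℕ) : Set (Colouring k n) :=
  {c | ∀ (φ : Fin N → Fin n) (h : StrictMono φ), restrictC c φ h ∉ F}

def OrderHereditary {k : ℕ} (P : ∀ n, Set (Colouring k n)) : Prop :=
  ∀ (m n : ℕ) (φ : Fin m → Fin n) (h : StrictMono φ) (c : Colouring k n),
    c ∈ P n → restrictC c φ h ∈ P m

noncomputable def exEnt {k n : ℕ} (A : Set (Colouring k n)) : ℝ :=
  sSup {x | ∃ t : Template k n, Proper t ∧ (∀ c, Realises c t → c ∈ A) ∧ Ent t = x}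

noncomputable def badPairs {k N n : ℕ} (t : Template k n) (F : Set (Colouring k N)) : ℕ :=
  Set.ncard {p : (Fin N → Fin n) × Colouring k N |
    ∃ h : StrictMono p.1, p.2 ∈ F ∧ Realises p.2 (restrictT t p.1 h)}

def TemplateLE {k m n : ℕ} (t : Template k m) (t' : Template k n) : Prop :=
  ∃ (φ : Fin m → Fin n) (h : StrictMono φ), ∀ e, t e ⊆ restrictT t' φ h e

def IsContainerFamily {k n : ℕ} (T : Finset (Template k n)) (A : Set (Colouring k n)) : Prop :=
  ∀ t : Template k n, Proper t → (∀ c, Realises c t → c ∈ A) → ∃ t' ∈ T, TemplateLE t t'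

section CondExp
open Classical in
/-- Finite conditional expectation. -/
noncomputable def cE {Z κ : Type*} [Fintype Z] (Q : Z → κ) (A : Z → ℝ) (z : Z) : ℝ :=
  (∑ z' : Z, if Q z' = Q z then A z' else 0) / (∑ z' : Z, if Q z' = Q z then (1:ℝ) else 0)

lemma cE_congr {Z κ : Type*} [Fintype Z] (Q : Z → κ) (A : Z → ℝ) {z w : Z} (h : Q z = Q w) :
    cE Q A z = cE Q A w := by
  unfold cE; rw [h]

lemma cE_den_pos {Z κ : Type*} [Fintype Z] (Q : Z → κ) (z : Z) [DecidableEq κ] :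
    0 < (∑ z' : Z, if Q z' = Q z then (1:ℝ) else 0) := by
  refine Finset.sum_pos' (fun i _ => by split_ifs <;> norm_num) ⟨z, Finset.mem_univ _, by simp⟩

lemma cE_nonneg {Z κ : Type*} [Fintype Z] (Q : Z → κ) (A : Z → ℝ) (hA : ∀ z, 0 ≤ A z) (z : Z) :
    0 ≤ cE Q A z := by
  unfold cE
  refine div_nonneg (Finset.sum_nonneg fun i _ => ?_) (Finset.sum_nonneg fun i _ => ?_)
  · split_ifs; exacts [hA _, le_rfl]
  · split_ifs <;> norm_num

lemma cE_le_one {Z κ : Type*} [Fintype Z] (Q : Z → κ) (A : Z → ℝ) (hA : ∀ z, A z ≤ 1) (z : Z) :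
    cE Q A z ≤ 1 := by
  classical
  unfold cE
  refine div_le_one_of_le₀ (Finset.sum_le_sum fun i _ => ?_) (Finset.sum_nonneg fun i _ => ?_)
  · split_ifs; exacts [hA _, le_rfl]
  · split_ifs <;> norm_num

lemma cE_sum {Z κ : Type*} [Fintype Z] (Q : Z → κ) (A : Z → ℝ) (h : Z → ℝ)
    (hh : ∀ z w, Q z = Q w → h z = h w) :
    ∑ z, cE Q A z * h z = ∑ z, A z * h z := by
  classical
  have key : ∀ z, cE Q A z * h z =
      ∑ z', (if Q z' = Q z then (1:ℝ) else 0) * (A z' * h z') /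
        (∑ w : Z, if Q w = Q z' then (1:ℝ) else 0) := by
    intro z
    unfold cE
    rw [div_mul_eq_mul_div, Finset.sum_mul, Finset.sum_div]
    refine Finset.sum_congr rfl fun z' _ => ?_
    by_cases hz : Q z' = Q z
    · simp only [hz, if_true, one_mul]
      rw [hh z' z hz]
    · simp [hz]
  simp_rw [key]
  rw [Finset.sum_comm]
  refine Finset.sum_congr rfl fun z' _ => ?_
  rw [← Finset.sum_div, ← Finset.sum_mul]
  have : (∑ i, if Q z' = Q i then (1:ℝ) else 0) = ∑ w : Z, if Q w = Q z' then (1:ℝ) else 0 :=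
    Finset.sum_congr rfl fun i _ => by simp only [eq_comm]
  rw [this, mul_div_assoc, mul_comm, div_mul_cancel₀ _ (cE_den_pos Q z').ne']

lemma cE_increment {Z κ κ' : Type*} [Fintype Z] (Q : Z → κ) (Q' : Z → κ') (A : Z → ℝ)
    (href : ∀ z w, Q' z = Q' w → Q z = Q w) :
    ∑ z, (cE Q' A z - cE Q A z) ^ 2 = ∑ z, (cE Q' A z)^2 - ∑ z, (cE Q A z)^2 := by
  have h1 : ∑ z, cE Q' A z * cE Q A z = ∑ z, A z * cE Q A z :=
    cE_sum Q' A _ fun z w h => cE_congr Q A (href z w h)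
  have h2 : ∑ z, cE Q A z * cE Q A z = ∑ z, A z * cE Q A z :=
    cE_sum Q A _ fun z w h => cE_congr Q A h
  have h3 : ∑ z, (cE Q' A z - cE Q A z) ^ 2 = ∑ z, (cE Q' A z)^2 + ∑ z, cE Q A z * cE Q A z
      - 2 * ∑ z, cE Q' A z * cE Q A z := by
    rw [Finset.mul_sum, ← Finset.sum_add_distrib, ← Finset.sum_sub_distrib]
    exact Finset.sum_congr rfl fun z _ => by ring
  have h4 : ∑ z, (cE Q A z)^2 = ∑ z, cE Q A z * cE Q A z :=
    Finset.sum_congr rfl fun z _ => by ring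
  rw [h3, h4, h1, h2]; ring

lemma cE_cut {Z κ κ' : Type*} [Fintype Z] (Q : Z → κ) (Q' : Z → κ') (A : Z → ℝ)
    (href : ∀ z w, Q' z = Q' w → Q z = Q w) (h : Z → ℝ) (hh : ∀ z w, Q' z = Q' w → h z = h w)
    (h01 : ∀ z, h z ^ 2 ≤ 1) :
    (∑ z, (cE Q A z - A z) * h z) ^ 2 ≤
      (∑ z, (cE Q' A z)^2 - ∑ z, (cE Q A z)^2) * Fintype.card Z := by
  have h1 : ∑ z, (cE Q A z - A z) * h z = - ∑ z, (cE Q' A z - cE Q A z) * h z := by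
    simp_rw [sub_mul, Finset.sum_sub_distrib, cE_sum Q' A h hh]; ring
  rw [h1, neg_sq, ← cE_increment Q Q' A href]
  refine (Finset.sum_mul_sq_le_sq_mul_sq _ _ _).trans ?_
  refine mul_le_mul_of_nonneg_left ?_ (Finset.sum_nonneg fun _ _ => sq_nonneg _)
  calc ∑ z, h z ^ 2 ≤ ∑ z : Z, (1:ℝ) := Finset.sum_le_sum fun z _ => h01 z
    _ = _ := by simp

/-- block labelling -/
def Qp {n : ℕ} (p : Fin n → ℕ) (z : Fin n × Fin n) : ℕ × ℕ := (p z.1, p z.2)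

open Classical in
/-- weak regularity -/
def WReg {k n : ℕ} (A : Fin k → Fin n × Fin n → ℝ) (η : ℝ) (p : Fin n → ℕ) : Prop :=
  ∀ i, ∀ S T : Fin n → Prop, ∑ z, (cE (Qp p) (A i) z - A i z) *
    (if S z.1 ∧ T z.2 then 1 else 0) ≤ η * (n:ℝ)^2

lemma weak_reg_aux {k n : ℕ} (A : Fin k → Fin n × Fin n → ℝ) (η : ℝ) (hη : 0 < η) (j : ℕ) :
    ∃ p : Fin n → ℕ, (∀ x, p x < 4 ^ j) ∧
      (WReg A η p ∨ j * η^2 * (n:ℝ)^2 ≤ ∑ i, ∑ z, (cE (Qp p) (A i) z)^2) := by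
  classical
  induction j with
  | zero =>
    refine ⟨fun _ => 0, by simp, Or.inr ?_⟩
    simp only [CharP.cast_eq_zero, zero_mul]
    positivity
  | succ j ih =>
    obtain ⟨p, hp, h⟩ := ih
    by_cases hreg : WReg A η p
    · exact ⟨p, fun x => (hp x).trans_le (Nat.pow_le_pow_right (by norm_num) (by omega)), Or.inl hreg⟩
    have h := h.resolve_left hreg
    unfold WReg at hreg
    push Not at hreg
    obtain ⟨i, S, T, hST⟩ := hreg
    let p' : Fin n → ℕ := fun x => 4 * p x + 2 * (if S x then 1 else 0) + (if T x then 1 else 0)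
    have hpp : ∀ x y, p' x = p' y → p x = p y ∧ (S x ↔ S y) ∧ (T x ↔ T y) := by
      intro x y hxy
      simp only [p'] at hxy
      by_cases h1 : S x <;> by_cases h2 : S y <;> by_cases h3 : T x <;> by_cases h4 : T y <;>
        simp only [h1, h2, h3, h4, if_true, if_false] at hxy ⊢ <;> first | omega | (refine ⟨?_, ?_, ?_⟩ <;> first | omega | trivial)
    refine ⟨p', fun x => ?_, Or.inr ?_⟩
    · have := hp x
      simp only [p', pow_succ]
      split_ifs <;> omega
    have href : ∀ z w, Qp p' z = Qp p' w → Qp p z = Qp p w := by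
      intro z w hzw
      simp only [Qp, Prod.mk.injEq] at hzw ⊢
      exact ⟨(hpp _ _ hzw.1).1, (hpp _ _ hzw.2).1⟩
    have hcut := cE_cut (Qp p) (Qp p') (A i) href
      (fun z => if S z.1 ∧ T z.2 then (1:ℝ) else 0) (by
        intro z w hzw
        simp only [Qp, Prod.mk.injEq] at hzw
        have h1 := (hpp _ _ hzw.1).2.1
        have h2 := (hpp _ _ hzw.2).2.2
        simp only [h1, h2]) (by intro z; split_ifs <;> norm_num)
    have hcard : (Fintype.card (Fin n × Fin n) : ℝ) = (n:ℝ)^2 := by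
      simp [sq]
    rw [hcard] at hcut
    have hn : 0 < (n:ℝ)^2 := by
      rcases Nat.eq_zero_or_pos n with h0 | h0
      · subst h0; simp at hST
      · positivity
    have hinc : η^2 * (n:ℝ)^2 ≤ ∑ z, (cE (Qp p') (A i) z)^2 - ∑ z, (cE (Qp p) (A i) z)^2 := by
      have h5 : (η * (n:ℝ)^2)^2 ≤ (∑ z, (cE (Qp p') (A i) z)^2 - ∑ z, (cE (Qp p) (A i) z)^2) * (n:ℝ)^2 :=
        (pow_le_pow_left₀ (by positivity) hST.le 2).trans hcut
      have h6 : (η * (n:ℝ)^2)^2 = (η^2 * (n:ℝ)^2) * (n:ℝ)^2 := by ring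
      rw [h6] at h5
      exact le_of_mul_le_mul_right h5 hn
    have hoth : ∀ i', 0 ≤ ∑ z, (cE (Qp p') (A i') z)^2 - ∑ z, (cE (Qp p) (A i') z)^2 := by
      intro i'
      rw [← cE_increment _ _ _ href]
      positivity
    have hsum := Finset.single_le_sum (fun i' _ => hoth i') (Finset.mem_univ i)
    rw [Finset.sum_sub_distrib] at hsum
    push_cast
    nlinarith

lemma weak_reg {k n : ℕ} (A : Fin k → Fin n × Fin n → ℝ) (hA0 : ∀ i z, 0 ≤ A i z)
    (hA1 : ∀ i z, A i z ≤ 1) (η : ℝ) (hη : 0 < η) (J : ℕ) (hJ : k < J * η^2) :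
    ∃ p : Fin n → ℕ, (∀ x, p x < 4 ^ J) ∧ WReg A η p := by
  classical
  obtain ⟨p, hp, h⟩ := weak_reg_aux A η hη J
  refine ⟨p, hp, h.elim id fun h => ?_⟩
  rcases Nat.eq_zero_or_pos n with h0 | h0
  · subst h0
    intro i S T
    simp
  · exfalso
    have : ∑ i, ∑ z, (cE (Qp p) (A i) z)^2 ≤ ∑ i : Fin k, ∑ z : Fin n × Fin n, (1:ℝ) := by
      refine Finset.sum_le_sum fun i _ => Finset.sum_le_sum fun z _ => ?_
      exact pow_le_one₀ (cE_nonneg _ _ (hA0 i) z) (cE_le_one _ _ (hA1 i) z)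
    simp only [Finset.sum_const, Finset.card_univ, Fintype.card_prod, Fintype.card_fin, nsmul_eq_mul, mul_one] at this
    push_cast at this
    have hn : 0 < (n:ℝ)^2 := by positivity
    nlinarith

/-- extreme points -/
lemma ext_pt {n : ℕ} (g u : Fin n → ℝ) (hu0 : ∀ x, 0 ≤ u x) (hu1 : ∀ x, u x ≤ 1) :
    ∑ x, g x * u x ≤ ∑ x, g x * (open Classical in if 0 < g x then 1 else 0) := by
  refine Finset.sum_le_sum fun x _ => ?_
  split_ifs with h
  · exact mul_le_mul_of_nonneg_left (hu1 x) h.le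
  · have := hu0 x; nlinarith

lemma WReg.fun {k n : ℕ} {A : Fin k → Fin n × Fin n → ℝ} {η : ℝ} {p : Fin n → ℕ}
    (h : WReg A η p) (i : Fin k) (u v : Fin n → ℝ) (hu0 : ∀ x, 0 ≤ u x) (hu1 : ∀ x, u x ≤ 1)
    (hv0 : ∀ x, 0 ≤ v x) (hv1 : ∀ x, v x ≤ 1) :
    ∑ x, ∑ y, (cE (Qp p) (A i) (x,y) - A i (x,y)) * (u x * v y) ≤ η * (n:ℝ)^2 := by
  classical
  set D : Fin n → Fin n → ℝ := fun x y => cE (Qp p) (A i) (x,y) - A i (x,y) with hD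
  have e1 : ∑ x, ∑ y, D x y * (u x * v y) = ∑ x, (∑ y, D x y * v y) * u x := by
    refine Finset.sum_congr rfl fun x _ => ?_
    rw [Finset.sum_mul]; exact Finset.sum_congr rfl fun y _ => by ring
  have e2 := ext_pt (fun x => ∑ y, D x y * v y) u hu0 hu1
  set S : Fin n → Prop := fun x => 0 < ∑ y, D x y * v y with hS
  have e3 : ∑ x, (∑ y, D x y * v y) * (if S x then 1 else 0)
      = ∑ y, (∑ x, D x y * (if S x then 1 else 0)) * v y := by
    simp_rw [Finset.sum_mul]
    rw [Finset.sum_comm]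
    exact Finset.sum_congr rfl fun x _ => Finset.sum_congr rfl fun y _ => by ring
  have e4 := ext_pt (fun y => ∑ x, D x y * (if S x then 1 else 0)) v hv0 hv1
  set T : Fin n → Prop := fun y => 0 < ∑ x, D x y * (if S x then 1 else 0) with hT
  have e5 := h i S T
  have e6 : ∑ y, (∑ x, D x y * (if S x then 1 else 0)) * (if T y then 1 else 0)
    = ∑ z : Fin n × Fin n, (cE (Qp p) (A i) z - A i z) * (if S z.1 ∧ T z.2 then 1 else 0) := by
    rw [Fintype.sum_prod_type, Finset.sum_comm]
    refine Finset.sum_congr rfl fun x _ => ?_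
    rw [Finset.sum_mul]
    refine Finset.sum_congr rfl fun y _ => ?_
    by_cases h1 : S y <;> by_cases h2 : T x <;> simp [h1, h2, hD]
  change ∑ x, ∑ y, D x y * (u x * v y) ≤ _
  rw [e1]
  refine e2.trans ?_
  have e7 := e4.trans (e6.le.trans (by convert e5))
  rw [← e3] at e7
  convert e7
end CondExp

section Counting

lemma sum_update {N n : ℕ} (i : Fin N) (G : (Fin N → Fin n) → ℝ) :
    ∑ φ : Fin N → Fin n, ∑ a : Fin n, G (Function.update φ i a) = n * ∑ φ, G φ := by
  have h1 : ∑ φ : Fin N → Fin n, ∑ a : Fin n, G (Function.update φ i a)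
      = ∑ q : (Fin N → Fin n) × Fin n, G (Function.update q.1 i q.2) := by
    rw [Fintype.sum_prod_type]
  have h2 : ∑ q : (Fin N → Fin n) × Fin n, G (Function.update q.1 i q.2)
      = ∑ q : (Fin N → Fin n) × Fin n, G q.1 := by
    have hinv : Function.Involutive
        (fun q : (Fin N → Fin n) × Fin n => (Function.update q.1 i q.2, q.1 i)) := by
      intro q; simp
    exact Fintype.sum_bijective _ hinv.bijective _ _ fun q => rfl
  rw [h1, h2, Fintype.sum_prod_type]
  simp [Finset.mul_sum]

lemma edge_step {N n : ℕ} (hn : 0 < n) (e₀ : Edge N) (D : Fin n → Fin n → ℝ)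
    (H : Edge N → Fin n → Fin n → ℝ) (H0 : ∀ e x y, 0 ≤ H e x y) (H1 : ∀ e x y, H e x y ≤ 1)
    (η : ℝ)
    (hD : ∀ u v : Fin n → ℝ, (∀ x, 0 ≤ u x) → (∀ x, u x ≤ 1) → (∀ x, 0 ≤ v x) → (∀ x, v x ≤ 1) →
      ∑ x, ∑ y, D x y * (u x * v y) ≤ η * (n:ℝ)^2) (s : Finset (Edge N)) (hs : e₀ ∉ s) :
    ∑ φ : Fin N → Fin n, D (φ e₀.1.1) (φ e₀.1.2) * ∏ e ∈ s, H e (φ e.1.1) (φ e.1.2)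
      ≤ η * (n:ℝ)^N := by
  classical
  set i := e₀.1.1 with hi
  set j := e₀.1.2 with hj
  have hij : i < j := e₀.2
  set G : (Fin N → Fin n) → ℝ := fun φ =>
    D (φ i) (φ j) * ∏ e ∈ s, H e (φ e.1.1) (φ e.1.2) with hG
  have key : ∀ φ : Fin N → Fin n,
      ∑ a, ∑ b, G (Function.update (Function.update φ i a) j b) ≤ η * (n:ℝ)^2 := by
    intro φ
    let u : Fin n → ℝ := fun a => ∏ e ∈ s with ¬ (e.1.1 = j ∨ e.1.2 = j),
      H e (Function.update φ i a e.1.1) (Function.update φ i a e.1.2)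
    let v : Fin n → ℝ := fun b => ∏ e ∈ s with (e.1.1 = j ∨ e.1.2 = j),
      H e (Function.update φ j b e.1.1) (Function.update φ j b e.1.2)
    refine le_trans (le_of_eq ?_) (hD u v ?_ ?_ ?_ ?_)
    · refine Finset.sum_congr rfl fun a _ => Finset.sum_congr rfl fun b _ => ?_
      simp only [hG]
      rw [Function.update_self, Function.update_of_ne hij.ne, Function.update_self]
      congr 1
      rw [← Finset.prod_filter_mul_prod_filter_not s (fun e => e.1.1 = j ∨ e.1.2 = j), mul_comm]
      congr 1
      · refine Finset.prod_congr rfl fun e he => ?_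
        rw [Finset.mem_filter] at he
        push Not at he
        rw [Function.update_of_ne he.2.1, Function.update_of_ne he.2.2]
      · refine Finset.prod_congr rfl fun e he => ?_
        rw [Finset.mem_filter] at he
        have hne : e ≠ e₀ := fun h => hs (h ▸ he.1)
        have hlt := e.2
        rcases he.2 with h | h
        · have h2 : e.1.2 ≠ i := by
            intro h2; rw [h, h2] at hlt; exact absurd hlt hij.asymm
          have h3 : e.1.2 ≠ j := by
            intro h2; rw [h, h2] at hlt; exact absurd hlt (lt_irrefl _)
          rw [h, Function.update_self, Function.update_self, Function.update_of_ne h3,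
            Function.update_of_ne h2, Function.update_of_ne h3]
        · have h2 : e.1.1 ≠ i := by
            intro h2
            exact hne (Subtype.ext (Prod.ext h2 h))
          have h3 : e.1.1 ≠ j := by
            intro h2; rw [h, h2] at hlt; exact absurd hlt (lt_irrefl _)
          rw [h, Function.update_self, Function.update_self, Function.update_of_ne h3,
            Function.update_of_ne h2, Function.update_of_ne h3]
    · exact fun x => Finset.prod_nonneg fun e _ => H0 _ _ _
    · exact fun x => Finset.prod_le_one (fun e _ => H0 _ _ _) fun e _ => H1 _ _ _
    · exact fun x => Finset.prod_nonneg fun e _ => H0 _ _ _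
    · exact fun x => Finset.prod_le_one (fun e _ => H0 _ _ _) fun e _ => H1 _ _ _
  have e1 : ∑ φ : Fin N → Fin n, ∑ a, ∑ b, G (Function.update (Function.update φ i a) j b)
      = n * (n * ∑ φ, G φ) := by
    rw [sum_update i (fun ψ => ∑ b, G (Function.update ψ j b)), sum_update j]
  have e2 : ∑ φ : Fin N → Fin n, ∑ a, ∑ b, G (Function.update (Function.update φ i a) j b)
      ≤ (n:ℝ)^N * (η * (n:ℝ)^2) := by
    refine (Finset.sum_le_sum fun φ _ => key φ).trans (le_of_eq ?_)
    simp
  rw [e1] at e2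
  have hn2 : 0 < (n:ℝ)^2 := by positivity
  refine le_of_mul_le_mul_left ?_ hn2
  calc (n:ℝ)^2 * ∑ φ, G φ = n * (n * ∑ φ, G φ) := by ring
    _ ≤ _ := e2
    _ = _ := by ring

lemma counting_lemma {N n : ℕ} (hn : 0 < n) (W A : Edge N → Fin n → Fin n → ℝ)
    (W0 : ∀ e x y, 0 ≤ W e x y) (W1 : ∀ e x y, W e x y ≤ 1)
    (A0 : ∀ e x y, 0 ≤ A e x y) (A1 : ∀ e x y, A e x y ≤ 1)
    (η : ℝ)
    (hD : ∀ e, ∀ u v : Fin n → ℝ, (∀ x, 0 ≤ u x) → (∀ x, u x ≤ 1) → (∀ x, 0 ≤ v x) →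
      (∀ x, v x ≤ 1) → ∑ x, ∑ y, (W e x y - A e x y) * (u x * v y) ≤ η * (n:ℝ)^2) :
    ∑ φ : Fin N → Fin n, ∏ e, W e (φ e.1.1) (φ e.1.2) ≤
      ∑ φ : Fin N → Fin n, ∏ e, A e (φ e.1.1) (φ e.1.2)
        + Fintype.card (Edge N) * (η * (n:ℝ)^N) := by
  classical
  have main : ∀ s : Finset (Edge N),
      ∑ φ : Fin N → Fin n, ∏ e, W e (φ e.1.1) (φ e.1.2) ≤
      ∑ φ : Fin N → Fin n, ∏ e, (if e ∈ s then A e else W e) (φ e.1.1) (φ e.1.2)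
        + s.card * (η * (n:ℝ)^N) := by
    intro s
    induction s using Finset.induction_on with
    | empty => simp
    | insert e₀ s he ih =>
      refine ih.trans ?_
      have hst := edge_step hn e₀ (fun x y => W e₀ x y - A e₀ x y)
        (fun e => if e ∈ s then A e else W e)
        (by intro e x y; split_ifs; exacts [A0 _ _ _, W0 _ _ _])
        (by intro e x y; split_ifs; exacts [A1 _ _ _, W1 _ _ _]) η (hD e₀)
        (Finset.univ.erase e₀) (Finset.notMem_erase _ _)
      have hrw : ∑ φ : Fin N → Fin n, (W e₀ (φ e₀.1.1) (φ e₀.1.2) - A e₀ (φ e₀.1.1) (φ e₀.1.2)) *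
          ∏ e ∈ Finset.univ.erase e₀, (if e ∈ s then A e else W e) (φ e.1.1) (φ e.1.2)
          = ∑ φ : Fin N → Fin n, ∏ e, (if e ∈ s then A e else W e) (φ e.1.1) (φ e.1.2)
          - ∑ φ : Fin N → Fin n, ∏ e, (if e ∈ insert e₀ s then A e else W e) (φ e.1.1) (φ e.1.2) := by
        rw [← Finset.sum_sub_distrib]
        refine Finset.sum_congr rfl fun φ _ => ?_
        rw [← Finset.mul_prod_erase Finset.univ (fun e => (if e ∈ s then A e else W e) (φ e.1.1) (φ e.1.2)) (Finset.mem_univ e₀),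
          ← Finset.mul_prod_erase Finset.univ (fun e => (if e ∈ insert e₀ s then A e else W e) (φ e.1.1) (φ e.1.2)) (Finset.mem_univ e₀)]
        have : ∏ e ∈ Finset.univ.erase e₀, (if e ∈ insert e₀ s then A e else W e) (φ e.1.1) (φ e.1.2)
          = ∏ e ∈ Finset.univ.erase e₀, (if e ∈ s then A e else W e) (φ e.1.1) (φ e.1.2) := by
          refine Finset.prod_congr rfl fun e hee => ?_
          simp [Finset.mem_insert, (Finset.mem_erase.1 hee).1]
        rw [this]
        simp only [he, if_false, Finset.mem_insert_self, if_true]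
        ring
      rw [hrw] at hst
      rw [Finset.card_insert_of_notMem he]
      push_cast
      linarith
  simpa using main Finset.univ

end Counting

section Supersat

lemma card_Edge (n : ℕ) : Fintype.card (Edge n) = n.choose 2 := by
  classical
  rw [Fintype.card_subtype, Nat.choose_two_right, ← Finset.sum_range_id]
  have : (Finset.univ.filter fun p : Fin n × Fin n => p.1 < p.2).card
      = ∑ y : Fin n, (Finset.univ.filter fun x : Fin n => x < y).card := by
    simp_rw [Finset.card_filter]
    rw [Fintype.sum_prod_type_right]
  rw [this, ← Fin.sum_univ_eq_sum_range (fun i => i) n]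
  refine Finset.sum_congr rfl fun y _ => ?_
  have : (Finset.univ.filter fun x : Fin n => x < y) = Finset.Iio y := by ext; simp
  rw [this, Fin.card_Iio]

lemma logb_nonneg_nat {k : ℕ} (hk : 2 ≤ k) (a : ℕ) : 0 ≤ Real.logb k a := by
  rcases Nat.eq_zero_or_pos a with h | h
  · simp [h]
  · exact Real.logb_nonneg (by exact_mod_cast hk) (by exact_mod_cast h)

lemma logb_le_one {k : ℕ} (hk : 2 ≤ k) (s : Finset (Fin k)) : Real.logb k s.card ≤ 1 := by
  rcases Nat.eq_zero_or_pos s.card with h | h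
  · simp [h]
  · have hk1 : (1:ℝ) < k := by exact_mod_cast hk
    rw [Real.logb_le_iff_le_rpow hk1 (by exact_mod_cast h), Real.rpow_one]
    have := s.card_le_univ
    rw [Fintype.card_fin] at this
    exact_mod_cast this

lemma Ent_nonneg {k n : ℕ} (hk : 2 ≤ k) (t : Template k n) : 0 ≤ Ent t :=
  Finset.sum_nonneg fun _ _ => logb_nonneg_nat hk _

lemma Ent_le {k n : ℕ} (hk : 2 ≤ k) (t : Template k n) : Ent t ≤ n.choose 2 := by
  rw [← card_Edge]
  refine (Finset.sum_le_sum fun e _ => logb_le_one hk (t e)).trans ?_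
  simp

lemma exEnt_finite {k n : ℕ} (A : Set (Colouring k n)) :
    {x | ∃ t : Template k n, Proper t ∧ (∀ c, Realises c t → c ∈ A) ∧ Ent t = x}.Finite := by
  refine (Set.finite_range (fun t : Template k n => Ent t)).subset ?_
  rintro x ⟨t, _, _, h⟩
  exact ⟨t, h⟩

lemma le_exEnt {k n : ℕ} (A : Set (Colouring k n)) (t : Template k n) (ht : Proper t)
    (h : ∀ c, Realises c t → c ∈ A) : Ent t ≤ exEnt A :=
  le_csSup (exEnt_finite A).bddAbove ⟨t, ht, h, rfl⟩

lemma exEnt_nonneg {k n : ℕ} (hk : 2 ≤ k) (A : Set (Colouring k n)) : 0 ≤ exEnt A := by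
  refine Real.sSup_nonneg ?_
  rintro x ⟨t, _, _, rfl⟩
  exact Ent_nonneg hk t

lemma exEnt_attained {k n : ℕ} (A : Set (Colouring k n)) (hA : A.Nonempty) :
    ∃ t : Template k n, Proper t ∧ (∀ c, Realises c t → c ∈ A) ∧ Ent t = exEnt A := by
  obtain ⟨c, hc⟩ := hA
  have hne : {x | ∃ t : Template k n, Proper t ∧ (∀ c, Realises c t → c ∈ A) ∧ Ent t = x}.Nonempty := by
    refine ⟨_, fun e => {c e}, fun e => Finset.singleton_nonempty _, fun c' hc' => ?_, rfl⟩
    have : c' = c := funext fun e => Finset.mem_singleton.1 (hc' e)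
    rwa [this]
  exact hne.csSup_mem (exEnt_finite A)

/-- bad embeddings -/
def IsBad {k N n : ℕ} (t : Template k n) (F : Set (Colouring k N)) (φ : Fin N → Fin n) : Prop :=
  ∃ h : StrictMono φ, ∃ f ∈ F, Realises f (restrictT t φ h)

open Classical in
lemma per_S {k N n m : ℕ} (hk : 2 ≤ k) (t : Template k n) (F : Set (Colouring k N))
    (S : Finset (Fin n)) (hS : S.card = m) :
    ∑ e : Edge n, (if {e.1.1, e.1.2} ⊆ S then Real.logb k (t e).card else 0) ≤
      exEnt (Forb F m) + m.choose 2 *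
        (∑ φ : Fin N → Fin n, (if IsBad t F φ ∧ Finset.univ.image φ ⊆ S then (1:ℝ) else 0) +
         ∑ e : Edge n, (if t e = ∅ ∧ {e.1.1, e.1.2} ⊆ S then (1:ℝ) else 0)) := by
  set ψ := S.orderEmbOfFin hS with hψ
  have hmono : StrictMono ψ := ψ.strictMono
  have hmem : ∀ i, ψ i ∈ S := fun i => S.orderEmbOfFin_mem hS i
  set tS := restrictT t ψ hmono with htS
  have hEnt : ∑ e : Edge n, (if {e.1.1, e.1.2} ⊆ S then Real.logb k (t e).card else 0)
      = Ent tS := by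
    rw [← Finset.sum_filter]
    symm
    refine Finset.sum_nbij (Edge.map ψ hmono) ?_ ?_ ?_ ?_
    · intro e _
      simp [Edge.map, Finset.insert_subset_iff, hmem]
    · intro e _ e' _ h
      simp only [Edge.map, Subtype.mk.injEq, Prod.mk.injEq] at h
      exact Subtype.ext (Prod.ext (ψ.injective h.1) (ψ.injective h.2))
    · intro e he
      simp only [Finset.coe_filter, Finset.mem_univ, true_and, Finset.insert_subset_iff,
        Finset.singleton_subset_iff, Set.mem_ofPred_eq] at he
      have hr := S.range_orderEmbOfFin hS
      have h1 : e.1.1 ∈ Set.range (S.orderEmbOfFin hS) := by rw [hr]; exact he.1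
      have h2 : e.1.2 ∈ Set.range (S.orderEmbOfFin hS) := by rw [hr]; exact he.2
      obtain ⟨a, ha⟩ := h1
      obtain ⟨b, hb⟩ := h2
      have hab : a < b := by
        have := e.2
        rw [← ha, ← hb] at this
        exact (OrderEmbedding.lt_iff_lt _).1 this
      exact ⟨⟨(a, b), hab⟩, by simp, Subtype.ext (Prod.ext ha hb)⟩
    · intro e _; rfl
  rw [hEnt]
  have hB0 : 0 ≤ ∑ φ : Fin N → Fin n,
      (if IsBad t F φ ∧ Finset.univ.image φ ⊆ S then (1:ℝ) else 0) :=
    Finset.sum_nonneg fun _ _ => by split_ifs <;> norm_num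
  have hZ0 : 0 ≤ ∑ e : Edge n, (if t e = ∅ ∧ {e.1.1, e.1.2} ⊆ S then (1:ℝ) else 0) :=
    Finset.sum_nonneg fun _ _ => by split_ifs <;> norm_num
  have hex := exEnt_nonneg hk (Forb F m)
  have hle := Ent_le hk tS
  have hm0 : (0:ℝ) ≤ m.choose 2 := by positivity
  by_cases hprop : Proper tS
  · by_cases hsub : ∀ c, Realises c tS → c ∈ Forb F m
    · have := le_exEnt _ tS hprop hsub
      have h2 := mul_nonneg hm0 (add_nonneg hB0 hZ0)
      linarith
    · push Not at hsub
      obtain ⟨c, hc, hcF⟩ := hsub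
      simp only [Forb, Set.mem_ofPred_eq, not_forall, not_not] at hcF
      obtain ⟨φ, h, hf⟩ := hcF
      have hbad : IsBad t F (ψ ∘ φ) := ⟨hmono.comp h, _, hf, fun e => hc (Edge.map φ h e)⟩
      have himg : Finset.univ.image (ψ ∘ φ) ⊆ S := by
        intro x hx
        obtain ⟨i, _, rfl⟩ := Finset.mem_image.1 hx
        exact hmem _
      have : (1:ℝ) ≤ ∑ φ : Fin N → Fin n,
          (if IsBad t F φ ∧ Finset.univ.image φ ⊆ S then (1:ℝ) else 0) := by
        have := Finset.single_le_sum (f := fun φ : Fin N → Fin n =>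
          (if IsBad t F φ ∧ Finset.univ.image φ ⊆ S then (1:ℝ) else 0))
          (fun φ _ => by split_ifs <;> norm_num) (Finset.mem_univ (ψ ∘ φ))
        simpa only [hbad, himg, and_self, if_true] using this
      nlinarith
  · unfold Proper at hprop
    push Not at hprop
    obtain ⟨e, he⟩ := hprop
    have himg : {(Edge.map ψ hmono e).1.1, (Edge.map ψ hmono e).1.2} ⊆ S := by
      simp [Edge.map, Finset.insert_subset_iff, hmem]
    have het : t (Edge.map ψ hmono e) = ∅ := he
    have : (1:ℝ) ≤ ∑ e : Edge n, (if t e = ∅ ∧ {e.1.1, e.1.2} ⊆ S then (1:ℝ) else 0) := by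
      have := Finset.single_le_sum (f := fun e : Edge n =>
          (if t e = ∅ ∧ {e.1.1, e.1.2} ⊆ S then (1:ℝ) else 0))
          (fun φ _ => by split_ifs <;> norm_num) (Finset.mem_univ (Edge.map ψ hmono e))
      simpa only [het, himg, and_self, if_true] using this
    nlinarith

lemma count_super {n m : ℕ} (U : Finset (Fin n)) (r : ℕ) (hU : U.card = r) (hr : r ≤ m) :
    ∑ S ∈ Finset.powersetCard m (Finset.univ : Finset (Fin n)), (if U ⊆ S then (1:ℝ) else 0)
      = ((n - r).choose (m - r) : ℕ) := by
  rw [Finset.sum_boole, Finset.card_filter_powersetCard_subset U Finset.univ m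
    (Finset.subset_univ _) (by omega), hU]
  simp

open Classical in
lemma supersat_raw {k N n m : ℕ} (hk : 2 ≤ k) (t : Template k n) (F : Set (Colouring k N))
    (hm2 : 2 ≤ m) (hmN : N ≤ m) :
    Ent t * ((n-2).choose (m-2) : ℕ) ≤ (n.choose m : ℕ) * exEnt (Forb F m) +
      m.choose 2 * ((∑ φ : Fin N → Fin n, if IsBad t F φ then (1:ℝ) else 0) *
          ((n-N).choose (m-N) : ℕ) +
        (∑ e : Edge n, if t e = ∅ then (1:ℝ) else 0) * ((n-2).choose (m-2) : ℕ)) := by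
  have hedge : ∀ e : Edge n, ({e.1.1, e.1.2} : Finset (Fin n)).card = 2 :=
    fun e => Finset.card_pair e.2.ne
  have hs := Finset.sum_le_sum (s := Finset.powersetCard m (Finset.univ : Finset (Fin n)))
    fun S hS => per_S hk t F S (Finset.mem_powersetCard.1 hS).2
  rw [Finset.sum_add_distrib, ← Finset.mul_sum, Finset.sum_add_distrib, Finset.sum_comm,
    Finset.sum_comm (f := fun (S : Finset (Fin n)) (φ : Fin N → Fin n) =>
      (if IsBad t F φ ∧ Finset.univ.image φ ⊆ S then (1:ℝ) else 0)),
    Finset.sum_comm (f := fun (S : Finset (Fin n)) (e : Edge n) =>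
      (if t e = ∅ ∧ {e.1.1, e.1.2} ⊆ S then (1:ℝ) else 0))] at hs
  have h1 : ∑ e : Edge n, ∑ S ∈ Finset.powersetCard m (Finset.univ : Finset (Fin n)),
      (if {e.1.1, e.1.2} ⊆ S then Real.logb k (t e).card else 0)
      = Ent t * ((n-2).choose (m-2) : ℕ) := by
    unfold Ent
    rw [Finset.sum_mul]
    refine Finset.sum_congr rfl fun e _ => ?_
    rw [← count_super {e.1.1, e.1.2} 2 (hedge e) hm2, Finset.mul_sum]
    exact Finset.sum_congr rfl fun S _ => by split_ifs <;> simp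
  have h2 : ∑ φ : Fin N → Fin n, ∑ S ∈ Finset.powersetCard m (Finset.univ : Finset (Fin n)),
      (if IsBad t F φ ∧ Finset.univ.image φ ⊆ S then (1:ℝ) else 0)
      = (∑ φ : Fin N → Fin n, if IsBad t F φ then (1:ℝ) else 0) * ((n-N).choose (m-N) : ℕ) := by
    rw [Finset.sum_mul]
    refine Finset.sum_congr rfl fun φ _ => ?_
    by_cases hb : IsBad t F φ
    · have hc : (Finset.univ.image φ).card = N := by
        rw [Finset.card_image_of_injective _ hb.1.injective]; simp
      rw [← count_super _ N hc hmN]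
      simp [hb]
    · simp [hb]
  have h3 : ∑ e : Edge n, ∑ S ∈ Finset.powersetCard m (Finset.univ : Finset (Fin n)),
      (if t e = ∅ ∧ {e.1.1, e.1.2} ⊆ S then (1:ℝ) else 0)
      = (∑ e : Edge n, if t e = ∅ then (1:ℝ) else 0) * ((n-2).choose (m-2) : ℕ) := by
    rw [Finset.sum_mul]
    refine Finset.sum_congr rfl fun e _ => ?_
    rw [← count_super {e.1.1, e.1.2} 2 (hedge e) hm2]
    by_cases hb : t e = ∅ <;> simp [hb]
  rw [h1, h2, h3] at hs
  refine hs.trans (le_of_eq ?_)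
  simp

open Classical in
lemma supersat {k N n m : ℕ} (hk : 2 ≤ k) (t : Template k n) (F : Set (Colouring k N))
    (hm2 : 2 ≤ m) (hmN : N ≤ m) (hmn : m ≤ n) :
    Ent t ≤ n.choose 2 * (exEnt (Forb F m) / m.choose 2) +
      m.choose N * n.choose 2 * ((∑ φ : Fin N → Fin n, if IsBad t F φ then (1:ℝ) else 0)
         / n.choose N) +
        m.choose 2 * (∑ e : Edge n, if t e = ∅ then (1:ℝ) else 0) := by
  have h := supersat_raw (n := n) hk t F hm2 hmN
  set B := ∑ φ : Fin N → Fin n, if IsBad t F φ then (1:ℝ) else 0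
  set Z := ∑ e : Edge n, if t e = ∅ then (1:ℝ) else 0
  have c2 : (n.choose m : ℝ) * m.choose 2 = n.choose 2 * (n-2).choose (m-2) := by
    exact_mod_cast Nat.choose_mul hm2
  have cN : (n.choose m : ℝ) * m.choose N = n.choose N * (n-N).choose (m-N) := by
    exact_mod_cast Nat.choose_mul hmN
  have p1 : (0:ℝ) < m.choose 2 := by exact_mod_cast Nat.choose_pos hm2
  have p2 : (0:ℝ) < n.choose N := by exact_mod_cast Nat.choose_pos (hmN.trans hmn)
  have p3 : (0:ℝ) < (n-2).choose (m-2) := by exact_mod_cast Nat.choose_pos (by omega)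
  have e1 : (n.choose m : ℝ) = n.choose 2 * (n-2).choose (m-2) / m.choose 2 := by
    rw [← c2]; field_simp
  have e2 : ((n-N).choose (m-N) : ℝ) = n.choose m * m.choose N / n.choose N := by
    rw [cN]; field_simp
  rw [e2, e1] at h
  refine le_of_mul_le_mul_right (h.trans (le_of_eq ?_)) p3
  field_simp
  ring

/-- lower bound pieces -/
lemma exEnt_mono {k N n m : ℕ} (hk : 2 ≤ k) (F : Set (Colouring k N)) (hne : (Forb F n).Nonempty)
    (hm2 : 2 ≤ m) (hmN : N ≤ m) (hmn : m ≤ n) :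
    exEnt (Forb F n) / n.choose 2 ≤ exEnt (Forb F m) / m.choose 2 := by
  classical
  obtain ⟨t, hp, ht, he⟩ := exEnt_attained _ hne
  have h := supersat hk t F hm2 hmN hmn
  have hB : ∀ φ, ¬ IsBad t F φ := by
    rintro φ ⟨hφ, f, hf, hr⟩
    choose c hc using hp
    let c' : Colouring k n := fun e => if h : ∃ e', Edge.map φ hφ e' = e then f h.choose else c e
    have hc' : Realises c' t := by
      intro e
      by_cases h : ∃ e', Edge.map φ hφ e' = e
      · simp only [c', h, dif_pos]
        have := hr h.choose
        simp only [restrictT] at this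
        rwa [h.choose_spec] at this
      · simp only [c', h, dif_neg, not_false_eq_true]; exact hc e
    refine ht c' hc' φ hφ ?_
    convert hf
    funext e
    have hex : ∃ e', Edge.map φ hφ e' = Edge.map φ hφ e := ⟨e, rfl⟩
    have hinj : hex.choose = e := by
      have hminj : ∀ e₁ e₂ : Edge N, Edge.map φ hφ e₁ = Edge.map φ hφ e₂ → e₁ = e₂ := by
        intro e₁ e₂ h
        simp only [Edge.map, Subtype.mk.injEq, Prod.mk.injEq] at h
        exact Subtype.ext (Prod.ext (hφ.injective h.1) (hφ.injective h.2))
      exact hminj _ _ hex.choose_spec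
    simp only [restrictC, c', hex, dif_pos, hinj]
  have hZ : ∀ e, t e ≠ ∅ := fun e => (hp e).ne_empty
  simp only [hB, hZ, if_false, Finset.sum_const_zero, zero_div, mul_zero, add_zero] at h
  have p1 : (0:ℝ) < n.choose 2 := by exact_mod_cast Nat.choose_pos (hm2.trans hmn)
  rw [← he, div_le_iff₀ p1]
  linarith

lemma rpow_Ent {k n : ℕ} (hk : 2 ≤ k) (t : Template k n) :
    (k:ℝ) ^ Ent t = ∏ e, max 1 ((t e).card : ℝ) := by
  have hk0 : (0:ℝ) < k := by positivity
  unfold Ent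
  rw [Real.rpow_sum_of_pos hk0]
  refine Finset.prod_congr rfl fun e _ => ?_
  rcases Nat.eq_zero_or_pos (t e).card with h | h
  · simp [h]
  · rw [Real.rpow_logb hk0 (by norm_cast; omega) (by exact_mod_cast h), max_eq_right]
    exact_mod_cast h

lemma lower_count {k n : ℕ} (hk : 2 ≤ k) (A : Set (Colouring k n)) (hA : A.Nonempty) :
    (k:ℝ) ^ exEnt A ≤ A.ncard := by
  classical
  obtain ⟨t, hp, ht, he⟩ := exEnt_attained _ hA
  rw [← he, rpow_Ent hk]
  have h1 : ∏ e, max 1 ((t e).card : ℝ) = ((Fintype.piFinset t).card : ℝ) := by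
    rw [Fintype.card_piFinset]
    push_cast
    refine Finset.prod_congr rfl fun e _ => max_eq_right ?_
    exact_mod_cast (hp e).card_pos
  rw [h1, ← Set.ncard_coe_finset]
  refine Nat.cast_le.2 (Set.ncard_le_ncard ?_ (Set.toFinite A))
  intro c hc
  exact ht c (Fintype.mem_piFinset.1 (by exact_mod_cast hc))

open Classical in
lemma near_count {k n : ℕ} (hk : 2 ≤ k) (t : Template k n) (D : ℕ) (x : ℝ) (hx : 0 < x)
    (hx1 : x ≤ 1) :
    ((Finset.univ.filter fun c : Colouring k n =>
      (Finset.univ.filter fun e => c e ∉ t e).card ≤ D).card : ℝ) ≤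
      (x⁻¹)^D * (1 + k * x)^(n.choose 2) * (k:ℝ)^ Ent t := by
  have h1 : ∀ c : Colouring k n, (Finset.univ.filter fun e => c e ∉ t e).card ≤ D →
      (1:ℝ) ≤ (x⁻¹)^D * ∏ e, (if c e ∈ t e then 1 else x) := by
    intro c hc
    rw [Finset.prod_ite]
    simp only [Finset.prod_const_one, one_mul, Finset.prod_const]
    have : x ^ D ≤ x ^ (Finset.univ.filter fun e => c e ∉ t e).card :=
      pow_le_pow_of_le_one hx.le hx1 hc
    rw [inv_pow, ← div_eq_inv_mul, le_div_iff₀ (by positivity), one_mul]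
    exact this
  have hpos : ∀ c : Colouring k n, 0 ≤ ∏ e, (if c e ∈ t e then 1 else x) :=
    fun c => Finset.prod_nonneg fun e _ => by split_ifs <;> positivity
  calc ((Finset.univ.filter fun c : Colouring k n =>
      (Finset.univ.filter fun e => c e ∉ t e).card ≤ D).card : ℝ)
      = ∑ c ∈ Finset.univ.filter fun c : Colouring k n =>
      (Finset.univ.filter fun e => c e ∉ t e).card ≤ D, (1:ℝ) := by simp
    _ ≤ ∑ c ∈ Finset.univ.filter fun c : Colouring k n =>
      (Finset.univ.filter fun e => c e ∉ t e).card ≤ D,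
        (x⁻¹)^D * ∏ e, (if c e ∈ t e then 1 else x) :=
        Finset.sum_le_sum fun c hc => h1 c (Finset.mem_filter.1 hc).2
    _ ≤ ∑ c : Colouring k n, (x⁻¹)^D * ∏ e, (if c e ∈ t e then 1 else x) :=
        Finset.sum_le_sum_of_subset_of_nonneg (Finset.subset_univ _)
          fun c _ _ => mul_nonneg (by positivity) (hpos c)
    _ = (x⁻¹)^D * ∏ e : Edge n, ∑ i : Fin k, (if i ∈ t e then 1 else x) := by
        rw [← Finset.mul_sum, Fintype.prod_sum]
    _ ≤ (x⁻¹)^D * ∏ e : Edge n, ((1 + k * x) * max 1 ((t e).card : ℝ)) := by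
        refine mul_le_mul_of_nonneg_left ?_ (by positivity)
        refine Finset.prod_le_prod (fun e _ => Finset.sum_nonneg fun i _ => by
          split_ifs <;> positivity) fun e _ => ?_
        have h3 : ∑ i : Fin k, (if i ∈ t e then 1 else x) ≤ (t e).card + k * x := by
          calc ∑ i : Fin k, (if i ∈ t e then 1 else x)
              ≤ ∑ i : Fin k, ((if i ∈ t e then 1 else 0) + x) :=
                Finset.sum_le_sum fun i _ => by split_ifs <;> linarith
            _ = _ := by simp [Finset.sum_add_distrib]
        have h4 : ((t e).card : ℝ) ≤ max 1 ((t e).card : ℝ) := le_max_right _ _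
        have h5 : (1:ℝ) ≤ max 1 ((t e).card : ℝ) := le_max_left _ _
        have h6 : 0 ≤ k * x := by positivity
        nlinarith
    _ = _ := by
        rw [Finset.prod_mul_distrib, rpow_Ent hk]
        simp [card_Edge, mul_assoc]

end Supersat

section Structure

open Classical in
/-- colour indicator -/
noncomputable def Aind {k n : ℕ} (c : Colouring k n) (i : Fin k) (z : Fin n × Fin n) : ℝ :=
  if ∃ h : z.1 < z.2, c ⟨z, h⟩ = i then 1 else 0

/-- blown-up template -/
def tpl {k n M : ℕ} (p : Fin n → Fin M) (T : Fin M × Fin M → Finset (Fin k)) : Template k n :=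
  fun e => T (p e.1.1, p e.1.2)

open Classical in
lemma structure_lemma {k N n : ℕ} (F : Set (Colouring k N)) (c : Colouring k n)
    (hc : c ∈ Forb F n) (hn : 0 < n) (δ η : ℝ) (hδ : 0 < δ) (hη : 0 < η) (J : ℕ)
    (hJ : k < J * η^2) :
    ∃ (p : Fin n → Fin (4^J)) (T : Fin (4^J) × Fin (4^J) → Finset (Fin k)),
      ((Finset.univ.filter fun e => c e ∉ tpl p T e).card : ℝ) ≤ k * δ * (n:ℝ)^2 ∧
      (∑ φ : Fin N → Fin n, if IsBad (tpl p T) F φ then (1:ℝ) else 0) * δ ^ Fintype.card (Edge N)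
        ≤ Fintype.card (Colouring k N) * (Fintype.card (Edge N) * (η * (n:ℝ)^N)) := by
  have A0 : ∀ i z, 0 ≤ Aind c i z := fun i z => by unfold Aind; split_ifs <;> norm_num
  have A1 : ∀ i z, Aind c i z ≤ 1 := fun i z => by unfold Aind; split_ifs <;> norm_num
  obtain ⟨p, hp, hreg⟩ := weak_reg (Aind c) A0 A1 η hη J hJ
  set W : Fin k → Fin n × Fin n → ℝ := fun i z => cE (Qp p) (Aind c i) z with hW
  have W0 : ∀ i z, 0 ≤ W i z := fun i z => cE_nonneg _ _ (A0 i) z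
  have W1 : ∀ i z, W i z ≤ 1 := fun i z => cE_le_one _ _ (A1 i) z
  let p' : Fin n → Fin (4^J) := fun x => ⟨p x, hp x⟩
  let T : Fin (4^J) × Fin (4^J) → Finset (Fin k) := fun ab => Finset.univ.filter fun i =>
    ∃ x y, p' x = ab.1 ∧ p' y = ab.2 ∧ δ ≤ W i (x, y)
  have hT : ∀ (e : Edge n) i, i ∈ tpl p' T e ↔ δ ≤ W i e.1 := by
    intro e i
    simp only [tpl, T, Finset.mem_filter, Finset.mem_univ, true_and]
    constructor
    · rintro ⟨x, y, hx, hy, h⟩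
      refine h.trans (le_of_eq (cE_congr _ _ ?_))
      simp only [p', Fin.mk.injEq] at hx hy
      simp [Qp, hx, hy]
    · intro h
      exact ⟨_, _, rfl, rfl, h⟩
  refine ⟨p', T, ?_, ?_⟩
  · have h1 : ((Finset.univ.filter fun e => c e ∉ tpl p' T e).card : ℝ)
        ≤ ∑ z : Fin n × Fin n, ∑ i, Aind c i z * (if W i z < δ then 1 else 0) := by
      have hinj : Function.Injective (fun e : Edge n => e.1) := Subtype.val_injective
      have hg : ∀ z : Fin n × Fin n, 0 ≤ ∑ i, Aind c i z * (if W i z < δ then 1 else 0) := by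
        intro z
        refine Finset.sum_nonneg fun i _ => mul_nonneg (A0 i z) ?_
        split_ifs <;> norm_num
      calc ((Finset.univ.filter fun e => c e ∉ tpl p' T e).card : ℝ)
          = ∑ e ∈ Finset.univ.filter fun e => c e ∉ tpl p' T e, (1:ℝ) := by simp
        _ ≤ ∑ e ∈ Finset.univ.filter fun e => c e ∉ tpl p' T e,
            ∑ i, Aind c i e.1 * (if W i e.1 < δ then 1 else 0) := by
            refine Finset.sum_le_sum fun e he => ?_
            have he' := (Finset.mem_filter.1 he).2
            rw [hT, not_le] at he'
            have hA : Aind c (c e) e.1 = 1 := by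
              unfold Aind; rw [if_pos]; exact ⟨e.2, rfl⟩
            have := Finset.single_le_sum
              (f := fun i => Aind c i e.1 * (if W i e.1 < δ then (1:ℝ) else 0))
              (fun i _ => mul_nonneg (A0 i e.1) (by split_ifs <;> norm_num)) (Finset.mem_univ (c e))
            simpa only [hA, he', if_true, mul_one] using this
        _ = ∑ z ∈ (Finset.univ.filter fun e => c e ∉ tpl p' T e).image (fun e : Edge n => e.1),
            ∑ i, Aind c i z * (if W i z < δ then 1 else 0) := by
            rw [Finset.sum_image fun a _ b _ h => hinj h]
        _ ≤ _ := Finset.sum_le_sum_of_subset_of_nonneg (Finset.subset_univ _) fun z _ _ => hg z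
    refine h1.trans ?_
    rw [Finset.sum_comm]
    have h2 : ∀ i, ∑ z, Aind c i z * (if W i z < δ then 1 else 0) ≤ δ * (n:ℝ)^2 := by
      intro i
      rw [← cE_sum (Qp p) (Aind c i) (fun z => if W i z < δ then (1:ℝ) else 0)]
      · calc ∑ z, cE (Qp p) (Aind c i) z * (if W i z < δ then 1 else 0)
            ≤ ∑ z : Fin n × Fin n, δ := by
              refine Finset.sum_le_sum fun z _ => ?_
              split_ifs with h
              · rw [mul_one]; exact h.le
              · rw [mul_zero]; exact hδ.le
          _ = _ := by simp; ring
      · intro z w hzw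
        have : W i z = W i w := cE_congr _ _ hzw
        rw [this]
    refine (Finset.sum_le_sum fun i _ => h2 i).trans (le_of_eq ?_)
    simp; ring
  · have hf : ∀ f ∈ F, ∑ φ : Fin N → Fin n, ∏ e : Edge N, W (f e) (φ e.1.1, φ e.1.2) ≤
        Fintype.card (Edge N) * (η * (n:ℝ)^N) := by
      intro f hf
      have := counting_lemma hn (fun e x y => W (f e) (x, y)) (fun e x y => Aind c (f e) (x, y))
        (fun e x y => W0 _ _) (fun e x y => W1 _ _) (fun e x y => A0 _ _) (fun e x y => A1 _ _) η
        (fun e u v hu0 hu1 hv0 hv1 => hreg.fun (f e) u v hu0 hu1 hv0 hv1)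
      refine this.trans (le_of_eq ?_)
      rw [add_eq_right]
      refine Finset.sum_eq_zero fun φ _ => ?_
      by_contra hne
      have hall : ∀ e : Edge N, ∃ h : φ e.1.1 < φ e.1.2, c ⟨(φ e.1.1, φ e.1.2), h⟩ = f e := by
        intro e
        by_contra hno
        refine hne (Finset.prod_eq_zero (Finset.mem_univ e) ?_)
        unfold Aind
        rw [if_neg]
        exact hno
      have hmono : StrictMono φ := fun a b hab => (hall ⟨(a, b), hab⟩).1
      refine hc φ hmono ?_
      convert hf
      funext e
      exact (hall e).2
    have h3 : ∀ φ : Fin N → Fin n, (if IsBad (tpl p' T) F φ then (1:ℝ) else 0) *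
        δ ^ Fintype.card (Edge N) ≤
        ∑ f ∈ Finset.univ.filter (fun f => f ∈ F), ∏ e : Edge N, W (f e) (φ e.1.1, φ e.1.2) := by
      intro φ
      have hnn : ∀ f ∈ Finset.univ.filter (fun f => f ∈ F),
          0 ≤ ∏ e : Edge N, W (f e) (φ e.1.1, φ e.1.2) :=
        fun f _ => Finset.prod_nonneg fun e _ => W0 _ _
      split_ifs with hb
      · obtain ⟨h, f, hfF, hr⟩ := hb
        refine le_trans ?_ (Finset.single_le_sum hnn (Finset.mem_filter.2 ⟨Finset.mem_univ f, hfF⟩))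
        rw [one_mul, ← Finset.card_univ, ← Finset.prod_const]
        refine Finset.prod_le_prod (fun _ _ => hδ.le) fun e _ => ?_
        exact (hT (Edge.map φ h e) (f e)).1 (hr e)
      · rw [zero_mul]; exact Finset.sum_nonneg hnn
    rw [Finset.sum_mul]
    refine (Finset.sum_le_sum fun φ _ => h3 φ).trans ?_
    rw [Finset.sum_comm]
    refine (Finset.sum_le_sum fun f hfm => hf f (Finset.mem_filter.1 hfm).2).trans ?_
    rw [Finset.sum_const, nsmul_eq_mul]
    refine mul_le_mul_of_nonneg_right ?_ (by positivity)
    exact_mod_cast Finset.card_le_univ _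

lemma n_sq_le {n : ℕ} (hn : 2 ≤ n) : (n:ℝ)^2 ≤ 4 * n.choose 2 := by
  rw [Nat.cast_choose_two]
  have : (2:ℝ) ≤ n := by exact_mod_cast hn
  nlinarith

lemma pow_le_c {n N : ℕ} (hn : 2 * N ≤ n) :
    (n:ℝ)^N ≤ 2^N * N.factorial * n.choose N := by
  have h := Nat.pow_le_choose (α := ℝ) N n
  rw [div_le_iff₀ (by positivity)] at h
  have h2 : (n:ℝ) ≤ 2 * (n + 1 - N : ℕ) := by
    have : n ≤ 2 * (n + 1 - N) := by omega
    exact_mod_cast this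
  calc (n:ℝ)^N ≤ (2 * (n + 1 - N : ℕ))^N := pow_le_pow_left₀ (by positivity) h2 N
    _ = 2^N * ((n + 1 - N : ℕ):ℝ)^N := by rw [mul_pow]
    _ ≤ 2^N * (n.choose N * N.factorial) := mul_le_mul_of_nonneg_left h (by positivity)
    _ = _ := by ring

open Classical in
lemma union_count {k n M : ℕ} (hk : 2 ≤ k) (A : Set (Colouring k n)) (D : ℕ) (E x : ℝ)
    (hx : 0 < x) (hx1 : x ≤ 1)
    (h : ∀ c ∈ A, ∃ (p : Fin n → Fin M) (T : Fin M × Fin M → Finset (Fin k)),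
      (Finset.univ.filter fun e => c e ∉ tpl p T e).card ≤ D ∧ Ent (tpl p T) ≤ E) :
    (A.ncard : ℝ) ≤ ((M:ℝ)^n * ((2:ℝ)^k)^(M*M)) *
      ((x⁻¹)^D * (1 + k * x)^(n.choose 2) * (k:ℝ)^ E) := by
  let G := Finset.univ.filter fun q : (Fin n → Fin M) × (Fin M × Fin M → Finset (Fin k)) =>
    Ent (tpl q.1 q.2) ≤ E
  let near : (Fin n → Fin M) × (Fin M × Fin M → Finset (Fin k)) → Finset (Colouring k n) :=
    fun q => Finset.univ.filter fun c : Colouring k n =>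
      (Finset.univ.filter fun e => c e ∉ tpl q.1 q.2 e).card ≤ D
  have hsub : A ⊆ ((G.biUnion near : Finset (Colouring k n)) : Set (Colouring k n)) := by
    intro c hc
    obtain ⟨p, T, h1, h2⟩ := h c hc
    rw [Finset.mem_coe, Finset.mem_biUnion]
    exact ⟨(p, T), Finset.mem_filter.2 ⟨Finset.mem_univ _, h2⟩,
      Finset.mem_filter.2 ⟨Finset.mem_univ _, h1⟩⟩
  have hk1 : (1:ℝ) ≤ k := by exact_mod_cast (by omega : 1 ≤ k)
  have h1 : (A.ncard : ℝ) ≤ (G.biUnion near).card := by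
    have := Set.ncard_le_ncard hsub (Finset.finite_toSet _)
    rw [Set.ncard_coe_finset] at this
    exact_mod_cast this
  have h2 : ((G.biUnion near).card : ℝ) ≤ ∑ q ∈ G, ((near q).card : ℝ) := by
    exact_mod_cast Finset.card_biUnion_le
  have h3 : ∑ q ∈ G, ((near q).card : ℝ) ≤
      ∑ q ∈ G, ((x⁻¹)^D * (1 + k * x)^(n.choose 2) * (k:ℝ)^ E) := by
    refine Finset.sum_le_sum fun q hq => (near_count hk _ D x hx hx1).trans ?_
    refine mul_le_mul_of_nonneg_left ?_ (by positivity)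
    exact Real.rpow_le_rpow_of_exponent_le hk1 (Finset.mem_filter.1 hq).2
  refine h1.trans (h2.trans (h3.trans ?_))
  rw [Finset.sum_const, nsmul_eq_mul]
  refine mul_le_mul_of_nonneg_right ?_ (by positivity)
  have h4 : G.card ≤ M^n * (2^k)^(M*M) := by
    refine (Finset.card_le_univ _).trans (le_of_eq ?_)
    simp
  exact_mod_cast h4

end Structure

set_option maxHeartbeats 2000000 in
lemma upper_bound (k N : ℕ) (hk : 2 ≤ k) (F : Set (Colouring k N)) (π : ℝ)
    (hπ : Tendsto (fun n => exEnt (Forb F n) / (n.choose 2 : ℝ)) atTop (nhds π))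
    (ε : ℝ) (hε : 0 < ε) :
    ∃ n₀ : ℕ, ∀ n, n₀ ≤ n →
      ((Forb F n).ncard : ℝ) ≤ (k : ℝ) ^ ((π + ε) * (n.choose 2 : ℝ)) := by
  classical
  have hk1 : (1:ℝ) < k := by exact_mod_cast hk
  have hk0 : (0:ℝ) < k := by positivity
  set L := Real.log k with hL
  have hL0 : 0 < L := Real.log_pos hk1
  -- the size m
  obtain ⟨m, hmπ, hmN, hm2⟩ := ((hπ.eventually_lt_const (show π < π + ε/8 by linarith)).and
    ((eventually_ge_atTop N).and (eventually_ge_atTop 2))).exists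
  have pm2 : (0:ℝ) < m.choose 2 := by exact_mod_cast Nat.choose_pos hm2
  have pmN : (0:ℝ) < m.choose N := by exact_mod_cast Nat.choose_pos hmN
  -- x
  set x : ℝ := min 1 (ε * L / (8 * k)) with hx
  have hx0 : 0 < x := lt_min one_pos (by positivity)
  have hx1 : x ≤ 1 := min_le_left _ _
  have hkx : k * x ≤ ε / 8 * L := by
    have : x ≤ ε * L / (8 * k) := min_le_right _ _
    rw [le_div_iff₀ (by positivity)] at this
    linarith
  set ℓ := Real.log x⁻¹ with hℓ
  have hℓ0 : 0 ≤ ℓ := Real.log_nonneg ((one_le_inv₀ hx0).2 hx1)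
  -- δ
  set δ : ℝ := min (ε * L / (32 * k * (ℓ + 1))) (ε / (32 * k * m.choose 2)) with hδ
  have hδ0 : 0 < δ := lt_min (by positivity) (by positivity)
  have hδ1 : 4 * k * δ * ℓ ≤ ε / 8 * L := by
    have : δ ≤ ε * L / (32 * k * (ℓ + 1)) := min_le_left _ _
    rw [le_div_iff₀ (by positivity)] at this
    have h2 : 0 ≤ k * δ := by positivity
    nlinarith
  have hδ2 : m.choose 2 * (4 * k * δ) ≤ ε / 8 := by
    have : δ ≤ ε / (32 * k * m.choose 2) := min_le_right _ _
    rw [le_div_iff₀ (by positivity)] at this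
    linarith
  -- η
  set r := Fintype.card (Edge N) with hr
  set κ := Fintype.card (Colouring k N) with hκ
  set C : ℝ := 2^N * N.factorial with hC
  have hC0 : 0 < C := by positivity
  set η : ℝ := ε * δ^r / (8 * m.choose N * (κ + 1) * (r + 1) * C) with hη
  have hη0 : 0 < η := by positivity
  have hη1 : m.choose N * (κ * (r * (η * C))) ≤ ε / 8 * δ^r := by
    have h1 : m.choose N * ((κ + 1) * ((r + 1) * (η * C))) = ε / 8 * δ^r := by
      rw [hη]; field_simp
    rw [← h1]
    have a1 : (κ:ℝ) ≤ κ + 1 := by linarith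
    have a2 : (r:ℝ) ≤ r + 1 := by linarith
    gcongr
  -- J
  obtain ⟨J, hJ⟩ := exists_nat_gt ((k:ℝ) / η^2)
  rw [div_lt_iff₀ (by positivity)] at hJ
  set M := 4^J with hM
  have hM1 : (1:ℝ) ≤ (M:ℝ) := by
    have : 1 ≤ M := Nat.one_le_pow _ _ (by norm_num)
    exact_mod_cast this
  -- n₀
  set a : ℝ := Real.log M + (M*M : ℕ) * (k * Real.log 2) with ha
  obtain ⟨n₁, hn₁⟩ := exists_nat_ge (a / (ε * L / 32))
  rw [div_le_iff₀ (by positivity)] at hn₁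
  refine ⟨max n₁ (max m (2 * N)), fun n hn => ?_⟩
  have hnn₁ : n₁ ≤ n := (le_max_left _ _).trans hn
  have hnm : m ≤ n := (le_max_left _ _).trans ((le_max_right _ _).trans hn)
  have hnN : 2 * N ≤ n := (le_max_right _ _).trans ((le_max_right _ _).trans hn)
  have hn2 : 2 ≤ n := hm2.trans hnm
  set c2 : ℝ := ((n.choose 2 : ℕ) : ℝ) with hc2
  have hc20 : 0 < c2 := by
    exact Nat.cast_pos.2 (Nat.choose_pos hn2)
  have hsq : (n:ℝ)^2 ≤ 4 * c2 := n_sq_le hn2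
  set D : ℕ := ⌊k * δ * (n:ℝ)^2⌋₊ with hD
  have hDle : (D:ℝ) ≤ 4 * k * δ * c2 := by
    refine (Nat.floor_le (by positivity)).trans ?_
    calc k * δ * (n:ℝ)^2 ≤ k * δ * (4 * c2) := mul_le_mul_of_nonneg_left hsq (by positivity)
      _ = _ := by ring
  have hcount := union_count (M := M) hk (Forb F n) D ((π + 3 * ε / 8) * c2) x hx0 hx1 (by
    intro c hc
    obtain ⟨p, T, h1, h2⟩ := structure_lemma F c hc (by omega) δ η hδ0 hη0 J hJ
    refine ⟨p, T, Nat.le_floor h1, ?_⟩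
    have hss := supersat hk (tpl p T) F hm2 hmN hnm
    set B := ∑ φ : Fin N → Fin n, if IsBad (tpl p T) F φ then (1:ℝ) else 0
    set Z := ∑ e : Edge n, if tpl p T e = ∅ then (1:ℝ) else 0 with hZ
    have hZle : Z ≤ 4 * k * δ * c2 := by
      have : Z ≤ ((Finset.univ.filter fun e => c e ∉ tpl p T e).card : ℝ) := by
        rw [hZ, Finset.sum_boole]
        norm_cast
        refine Finset.card_le_card fun e he => ?_
        have := (Finset.mem_filter.1 he).2
        simp [this]
      refine this.trans (h1.trans ?_)
      calc k * δ * (n:ℝ)^2 ≤ k * δ * (4 * c2) := mul_le_mul_of_nonneg_left hsq (by positivity)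
        _ = _ := by ring
    have hBle : m.choose N * (B / n.choose N) ≤ ε / 8 := by
      have pnN : (0:ℝ) < n.choose N := by exact_mod_cast Nat.choose_pos (hmN.trans hnm)
      have hpow : (n:ℝ)^N ≤ C * n.choose N := pow_le_c hnN
      rw [mul_div_assoc', div_le_iff₀ pnN]
      refine le_of_mul_le_mul_right ?_ (pow_pos hδ0 r)
      calc m.choose N * B * δ^r = m.choose N * (B * δ^r) := by ring
        _ ≤ m.choose N * (κ * (r * (η * (n:ℝ)^N))) := by gcongr
        _ ≤ m.choose N * (κ * (r * (η * (C * n.choose N)))) := by gcongr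
        _ = (m.choose N * (κ * (r * (η * C)))) * n.choose N := by ring
        _ ≤ (ε / 8 * δ^r) * n.choose N := by gcongr
        _ = _ := by ring
    calc Ent (tpl p T) ≤ _ := hss
      _ = c2 * (exEnt (Forb F m) / m.choose 2) + c2 * (m.choose N * (B / n.choose N))
          + m.choose 2 * Z := by ring
      _ ≤ c2 * (π + ε/8) + c2 * (ε/8) + m.choose 2 * (4 * k * δ * c2) := by gcongr
      _ = c2 * (π + ε/8) + c2 * (ε/8) + (m.choose 2 * (4 * k * δ)) * c2 := by ring
      _ ≤ c2 * (π + ε/8) + c2 * (ε/8) + (ε / 8) * c2 := by gcongr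
      _ = _ := by ring)
  refine hcount.trans ?_
  have hkx0 : 0 < 1 + k * x := by positivity
  rw [← Real.log_le_log_iff (by positivity) (by positivity)]
  have hM0 : (M:ℝ) ≠ 0 := by positivity
  rw [Real.log_mul (by positivity) (by positivity), Real.log_mul (by positivity) (by positivity),
    Real.log_mul (by positivity) (by positivity), Real.log_mul (by positivity) (by positivity),
    Real.log_pow, Real.log_pow, Real.log_pow, Real.log_pow, Real.log_pow, Real.log_rpow hk0,
    Real.log_rpow hk0]
  have b1 : D * ℓ ≤ ε / 8 * L * c2 := by
    calc D * ℓ ≤ (4 * k * δ * c2) * ℓ := by gcongr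
      _ = (4 * k * δ * ℓ) * c2 := by ring
      _ ≤ _ := by gcongr
  have b2 : c2 * Real.log (1 + k * x) ≤ c2 * (ε / 8 * L) := by
    have := Real.log_le_sub_one_of_pos hkx0
    refine mul_le_mul_of_nonneg_left ?_ hc20.le
    linarith
  have b3 : n * Real.log M + (M*M : ℕ) * (k * Real.log 2) ≤ ε / 8 * L * c2 := by
    have hn1 : (1:ℝ) ≤ n := by exact_mod_cast (by omega : 1 ≤ n)
    have hnn : (n₁:ℝ) ≤ n := by exact_mod_cast hnn₁
    have g1 : 0 ≤ (M*M : ℕ) * (k * Real.log 2) := by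
      have := Real.log_nonneg (show (1:ℝ) ≤ 2 by norm_num)
      positivity
    have g2 : a ≤ n * (ε * L / 32) := hn₁.trans (by gcongr)
    calc n * Real.log M + (M*M : ℕ) * (k * Real.log 2) ≤ n * a := by rw [ha]; nlinarith
      _ ≤ n * (n * (ε * L / 32)) := by gcongr
      _ = (ε * L / 32) * (n:ℝ)^2 := by ring
      _ ≤ (ε * L / 32) * (4 * c2) := by gcongr
      _ = _ := by ring
  have b4 : 0 < ε * L * c2 := by positivity
  rw [← hL, ← hℓ, ← hc2]
  nlinarith

/-- Counting theorem for finitely forbidden families (Theorem 2.14). -/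
theorem counting_finitely_forbidden (k N : ℕ) (hk : 2 ≤ k)
    (F : Set (Colouring k N)) (hF : F.Nonempty)
    (hne : ∀ n, (Forb F n).Nonempty) (π : ℝ)
    (hπ : Tendsto (fun n => exEnt (Forb F n) / (n.choose 2 : ℝ)) atTop (nhds π))
    (ε : ℝ) (hε : 0 < ε) :
    ∃ n₀ : ℕ, ∀ n, n₀ ≤ n →
      (k : ℝ) ^ (π * (n.choose 2 : ℝ)) ≤ ((Forb F n).ncard : ℝ) ∧
      ((Forb F n).ncard : ℝ) ≤ (k : ℝ) ^ ((π + ε) * (n.choose 2 : ℝ)) := by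
  classical
  obtain ⟨n₀, h⟩ := upper_bound k N hk F π hπ ε hε
  refine ⟨max n₀ (max 2 N), fun n hn => ⟨?_, h n ((le_max_left _ _).trans hn)⟩⟩
  have hn2 : 2 ≤ n := (le_max_left _ _).trans ((le_max_right _ _).trans hn)
  have hnN : N ≤ n := (le_max_right _ _).trans ((le_max_right _ _).trans hn)
  have hle : π ≤ exEnt (Forb F n) / (n.choose 2 : ℝ) := by
    refine le_of_tendsto hπ ?_
    filter_upwards [eventually_ge_atTop n] with n' hn'
    exact exEnt_mono hk F (hne n') hn2 hnN hn'
  have p1 : (0:ℝ) < n.choose 2 := by exact_mod_cast Nat.choose_pos hn2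
  rw [le_div_iff₀ p1] at hle
  refine le_trans ?_ (lower_count hk _ (hne n))
  exact Real.rpow_le_rpow_of_exponent_le (by exact_mod_cast (by omega : 1 ≤ k)) hle
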